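/- Let H = (H₀,H₁,H₂) ∈ (0,1)³ and ε ∈ (0, min(H₀, 1/4)). Then there exists a constant C > 0, depending only on H and ε, such that for all integers 0 ≤ n ≤ m, all s, t ∈ [0,1] and every η = (η₁,η₂) ∈ ℝ² with η₁ ≠ 0, η₂ ≠ 0 and ‖η‖ ≤ 2^m, one has |η₁|^{1−2H₁} |η₂|^{1−2H₂} · | ∫_{A_{n,m}(η)} (γ_t(ξ,‖η‖) − γ_s(ξ,‖η‖)) · conj(γ_t(ξ,‖η‖)) · |ξ|^{1−2H₀} dξ | ≤ C · 2^{−nε} |t−s|^{ε} · ( K^{(H₀−ε,H₁,H₂)}(η) + K^{(H₀,H₁−ε,H₂)}(η) + K^{(H₀,H₁,H₂−ε)}(η) ), where A_{n,m}(η) = { ξ ∈ ℝ : |ξ| ≤ 2^m } if ‖η‖ > 2^n, and A_{n,m}(η) = { ξ ∈ ℝ : 2^n < |ξ| ≤ 2^m } if ‖η‖ ≤ 2^n. -/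

import Mathlib

open MeasureTheory Set

/-- `γ_t(ξ,ρ) = e^{iξt} ∫₀^t e^{−iξs} (sin(sρ)/ρ) ds`. -/
noncomputable def gam (t ξ ρ : ℝ) : ℂ :=
  Complex.exp (Complex.I * ξ * t) *
    ∫ s in (0:ℝ)..t, Complex.exp (-(Complex.I * ξ * s)) * ((Real.sin (s * ρ) / ρ : ℝ) : ℂ)

/-- The kernel `K^H(η) = |η₁|^{1−2H₁}|η₂|^{1−2H₂}/(1+‖η‖^{1+2H₀})` on `ℝ²`,
where `‖η‖ = √(η₁²+η₂²)` is the Euclidean norm. -/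
noncomputable def Kker (H₀ H₁ H₂ x y : ℝ) : ℝ :=
  |x| ^ (1 - 2*H₁) * |y| ^ (1 - 2*H₂) / (1 + Real.sqrt (x^2 + y^2) ^ (1 + 2*H₀))

/-- The ξ-section `A_{n,m}(η)` of the domain `D^m \ D^n`. -/
noncomputable def Anm (n m : ℕ) (ρ : ℝ) : Set ℝ :=
  if 2^n < ρ then {ξ : ℝ | |ξ| ≤ 2^m} else {ξ : ℝ | 2^n < |ξ| ∧ |ξ| ≤ 2^m}

/-- The model profile `|u|^b` near the origin and `|u|^c` away from it. -/
noncomputable def powProfile (b c u : ℝ) : ℝ := if |u| ≤ 1 then |u| ^ b else |u| ^ c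

lemma powProfile_nonneg (b c u : ℝ) : 0 ≤ powProfile b c u := by
  unfold powProfile
  split_ifs <;> positivity

lemma powProfile_neg (b c u : ℝ) : powProfile b c (-u) = powProfile b c u := by
  simp [powProfile]

lemma integrable_powProfile {b c : ℝ} (hb : -1 < b) (hc : c < -1) :
    Integrable (powProfile b c) := by
  have h1 : IntegrableOn (powProfile b c) (Ioc 0 1) := by
    have h : IntegrableOn (fun x : ℝ => x ^ b) (Ioc 0 1) :=
      (intervalIntegrable_iff_integrableOn_Ioc_of_le zero_le_one).1
        (intervalIntegral.intervalIntegrable_rpow' hb)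
    refine h.congr_fun (fun x hx => ?_) measurableSet_Ioc
    simp [powProfile, abs_of_pos hx.1, hx.2]
  have h2 : IntegrableOn (powProfile b c) (Ioi 1) := by
    refine (integrableOn_Ioi_rpow_of_lt hc zero_lt_one).congr_fun (fun x hx => ?_)
      measurableSet_Ioi
    have hx' : (1 : ℝ) < x := hx
    simp [powProfile, abs_of_pos (zero_lt_one.trans hx'), not_le.2 hx']
  have h3 : IntegrableOn (powProfile b c) (Ioi 0) := by
    rw [← Ioc_union_Ioi_eq_Ioi (zero_le_one' ℝ)]
    exact h1.union h2
  have h4 : Integrable ((Ioi (0 : ℝ)).indicator (powProfile b c)) :=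
    h3.integrable_indicator measurableSet_Ioi
  refine (h4.add h4.comp_neg).congr ?_
  filter_upwards [Measure.ae_ne volume (0 : ℝ)] with x hx
  rcases lt_or_gt_of_ne hx with h | h
  · simp [indicator, h, h.le, powProfile_neg]
  · simp [indicator, h, h.le]

lemma sq_sub_sq_mul_integral_exp_mul_sin (t ξ : ℝ) {ρ : ℝ} (hρ : 0 < ρ) :
    ((ξ : ℂ) ^ 2 - (ρ : ℂ) ^ 2) * ∫ s in (0:ℝ)..t,
      Complex.exp (-(Complex.I * ξ * s)) * ((Real.sin (s * ρ) / ρ : ℝ) : ℂ) =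
    Complex.exp (-(Complex.I * ξ * t)) *
      ((Real.cos (t * ρ) : ℂ) + Complex.I * ξ * ((Real.sin (t * ρ) / ρ : ℝ) : ℂ)) - 1 := by
  have hρ' : (ρ : ℂ) ≠ 0 := by exact_mod_cast hρ.ne'
  have hderiv : ∀ x : ℝ, HasDerivAt (fun s : ℝ => Complex.exp (-(Complex.I * ξ * s)) *
      ((Real.cos (s * ρ) : ℂ) + Complex.I * ξ * ((Real.sin (s * ρ) / ρ : ℝ) : ℂ)))
      (((ξ : ℂ) ^ 2 - (ρ : ℂ) ^ 2) *
        (Complex.exp (-(Complex.I * ξ * x)) * ((Real.sin (x * ρ) / ρ : ℝ) : ℂ))) x := by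
    intro x
    have hid : HasDerivAt (fun s : ℝ => s * ρ) ρ x := by
      simpa using (hasDerivAt_id x).mul_const ρ
    have hc := hid.cos.ofReal_comp
    have hs := (hid.sin.div_const ρ).ofReal_comp
    have he : HasDerivAt (fun s : ℝ => Complex.exp (-(Complex.I * ξ * s)))
        (Complex.exp (-(Complex.I * ξ * x)) * (-(Complex.I * ξ))) x := by
      have : HasDerivAt (fun s : ℝ => -(Complex.I * ξ * (s : ℂ))) (-(Complex.I * ξ)) x := by
        simpa using ((hasDerivAt_id x).ofReal_comp.const_mul (Complex.I * (ξ : ℂ))).fun_neg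
      exact this.cexp
    refine (he.fun_mul (hc.fun_add (hs.const_mul (Complex.I * (ξ : ℂ))))).congr_deriv ?_
    push_cast
    field_simp
    linear_combination (-(ξ : ℂ) ^ 2 * Complex.sin (x * ρ)) * Complex.I_sq
  rw [← intervalIntegral.integral_const_mul,
    intervalIntegral.integral_eq_sub_of_hasDerivAt (fun x _ => hderiv x)]
  · simp
  · apply Continuous.intervalIntegrable
    fun_prop

lemma norm_exp_I_mul_mul (x y : ℝ) : ‖Complex.exp (Complex.I * x * y)‖ = 1 := by
  have h : Complex.I * x * y = ((x * y : ℝ) : ℂ) * Complex.I := by push_cast; ring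
  rw [h, Complex.norm_exp_ofReal_mul_I]

lemma norm_exp_neg_I_mul_mul (x y : ℝ) : ‖Complex.exp (-(Complex.I * x * y))‖ = 1 := by
  rw [Complex.exp_neg, norm_inv, norm_exp_I_mul_mul, inv_one]

lemma sq_sub_sq_mul_gam (t ξ : ℝ) {ρ : ℝ} (hρ : 0 < ρ) :
    ((ξ : ℂ) ^ 2 - (ρ : ℂ) ^ 2) * gam t ξ ρ =
      (Real.cos (t * ρ) : ℂ) + Complex.I * ξ * ((Real.sin (t * ρ) / ρ : ℝ) : ℂ) -
        Complex.exp (Complex.I * ξ * t) := by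
  have h := sq_sub_sq_mul_integral_exp_mul_sin t ξ hρ
  have he : Complex.exp (Complex.I * ξ * t) * Complex.exp (-(Complex.I * ξ * t)) = 1 := by
    rw [← Complex.exp_add]; simp
  rw [gam, mul_left_comm, h, mul_sub, ← mul_assoc, he, one_mul, mul_one]

lemma abs_sin_mul_div_le {t ρ : ℝ} (ht : t ∈ Icc (0 : ℝ) 1) (hρ : 0 < ρ) :
    |Real.sin (t * ρ) / ρ| ≤ 2 / (1 + ρ) := by
  rw [abs_div, abs_of_pos hρ, div_le_div_iff₀ hρ (by linarith)]
  have h1 := Real.abs_sin_le_one (t * ρ)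
  have h2 : |Real.sin (t * ρ)| ≤ ρ := by
    refine Real.abs_sin_le_abs.trans ?_
    rw [abs_of_nonneg (mul_nonneg ht.1 hρ.le)]
    nlinarith [ht.2]
  nlinarith

lemma norm_gam_le_two_div {t ρ : ℝ} (ξ : ℝ) (ht : t ∈ Icc (0 : ℝ) 1) (hρ : 0 < ρ) :
    ‖gam t ξ ρ‖ ≤ 2 / (1 + ρ) := by
  rw [gam, norm_mul, norm_exp_I_mul_mul, one_mul]
  have h := intervalIntegral.norm_integral_le_of_norm_le_const (a := 0) (b := t)
    (C := 2 / (1 + ρ))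
    (f := fun s : ℝ => Complex.exp (-(Complex.I * ξ * s)) * ((Real.sin (s * ρ) / ρ : ℝ) : ℂ))
    (fun s hs => by
      rw [uIoc_of_le ht.1] at hs
      rw [norm_mul, norm_exp_neg_I_mul_mul, one_mul, Complex.norm_real, Real.norm_eq_abs]
      exact abs_sin_mul_div_le ⟨hs.1.le, hs.2.trans ht.2⟩ hρ)
  refine h.trans ?_
  rw [sub_zero, abs_of_nonneg ht.1]
  exact mul_le_of_le_one_right (by positivity) ht.2

lemma norm_gam_le {t ρ : ℝ} (ξ : ℝ) (ht : t ∈ Icc (0 : ℝ) 1) (hρ : 0 < ρ) :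
    ‖gam t ξ ρ‖ ≤ 8 / ((1 + ρ) * (1 + |(|ξ| - ρ)|)) := by
  have hξ := abs_nonneg ξ
  have hw := abs_nonneg (|ξ| - ρ)
  have hR : 0 < 1 + ρ := by linarith
  have h1 : ‖gam t ξ ρ‖ * (1 + ρ) ≤ 2 := (le_div_iff₀ hR).1 (norm_gam_le_two_div ξ ht hρ)
  have hg := norm_nonneg (gam t ξ ρ)
  suffices h : |(|ξ| - ρ)| * (‖gam t ξ ρ‖ * (1 + ρ)) ≤ 6 by
    rw [le_div_iff₀ (by positivity)]
    linarith
  rcases le_total (|ξ| + ρ) 1 with h | h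
  · have : |(|ξ| - ρ)| ≤ 1 := abs_le.2 ⟨by linarith, by linarith⟩
    nlinarith [mul_nonneg hg hR.le]
  · have h2 : |(|ξ| - ρ)| * (|ξ| + ρ) * ‖gam t ξ ρ‖ ≤ 2 + |ξ| * (2 / (1 + ρ)) := by
      have e : |(|ξ| - ρ)| * (|ξ| + ρ) = ‖(ξ : ℂ) ^ 2 - (ρ : ℂ) ^ 2‖ := by
        rw [← Complex.ofReal_pow, ← Complex.ofReal_pow, ← Complex.ofReal_sub,
          Complex.norm_real, Real.norm_eq_abs, ← sq_abs ξ, sq_sub_sq, abs_mul,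
          abs_of_pos (by linarith : 0 < |ξ| + ρ), mul_comm]
      rw [e, ← norm_mul, sq_sub_sq_mul_gam t ξ hρ]
      refine (norm_sub_le _ _).trans ?_
      rw [norm_exp_I_mul_mul]
      have h3 := norm_add_le (Real.cos (t * ρ) : ℂ)
        (Complex.I * ξ * ((Real.sin (t * ρ) / ρ : ℝ) : ℂ))
      rw [norm_mul, norm_mul, Complex.norm_I, one_mul, Complex.norm_real, Complex.norm_real,
        Complex.norm_real, Real.norm_eq_abs, Real.norm_eq_abs, Real.norm_eq_abs] at h3
      have h4 := Real.abs_cos_le_one (t * ρ)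
      have h5 := mul_le_mul_of_nonneg_left (abs_sin_mul_div_le ht hρ) hξ
      linarith
    have h6 : 2 / (1 + ρ) * (1 + ρ) = 2 := by field_simp
    have h7 := mul_le_mul_of_nonneg_right h2 hR.le
    have h8 : (|ξ| + ρ) * (|(|ξ| - ρ)| * (‖gam t ξ ρ‖ * (1 + ρ))) ≤ (|ξ| + ρ) * 6 := by
      calc _ = |(|ξ| - ρ)| * (|ξ| + ρ) * ‖gam t ξ ρ‖ * (1 + ρ) := by ring
        _ ≤ (2 + |ξ| * (2 / (1 + ρ))) * (1 + ρ) := h7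
        _ = 2 * (1 + ρ) + |ξ| * (2 / (1 + ρ) * (1 + ρ)) := by ring
        _ ≤ _ := by rw [h6]; linarith
    exact le_of_mul_le_mul_left h8 (by linarith)

lemma hasDerivAt_gam (t ξ ρ : ℝ) :
    HasDerivAt (fun u => gam u ξ ρ)
      (Complex.I * ξ * gam t ξ ρ + ((Real.sin (t * ρ) / ρ : ℝ) : ℂ)) t := by
  have hcont : Continuous fun s : ℝ =>
      Complex.exp (-(Complex.I * ξ * s)) * ((Real.sin (s * ρ) / ρ : ℝ) : ℂ) := by fun_prop
  have h1 := (hcont.integral_hasStrictDerivAt 0 t).hasDerivAt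
  have h2 : HasDerivAt (fun s : ℝ => Complex.exp (Complex.I * ξ * s))
      (Complex.exp (Complex.I * ξ * t) * (Complex.I * ξ)) t := by
    have : HasDerivAt (fun s : ℝ => Complex.I * ξ * (s : ℂ)) (Complex.I * ξ) t := by
      simpa using (hasDerivAt_id t).ofReal_comp.const_mul (Complex.I * (ξ : ℂ))
    exact this.cexp
  have he : Complex.exp (Complex.I * ξ * t) * Complex.exp (-(Complex.I * ξ * t)) = 1 := by
    rw [← Complex.exp_add]; simp
  refine (h2.mul h1).congr_deriv ?_
  rw [gam, ← mul_assoc (Complex.exp (Complex.I * ξ * t)) (Complex.exp (-(Complex.I * ξ * t))),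
    he]
  ring

lemma norm_gam_sub_gam_le {s t ρ : ℝ} (ξ : ℝ) (hs : s ∈ Icc (0 : ℝ) 1)
    (ht : t ∈ Icc (0 : ℝ) 1) (hρ : 0 < ρ) :
    ‖gam t ξ ρ - gam s ξ ρ‖ ≤
      10 * (1 + |ξ| + ρ) / ((1 + ρ) * (1 + |(|ξ| - ρ)|)) * |t - s| := by
  have hξ := abs_nonneg ξ
  have hw : |(|ξ| - ρ)| ≤ |ξ| + ρ := abs_le.2 ⟨by linarith, by linarith⟩
  have hw0 := abs_nonneg (|ξ| - ρ)
  refine Convex.norm_image_sub_le_of_norm_hasDerivWithin_le (s := Icc (0 : ℝ) 1)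
    (fun u _ => (hasDerivAt_gam u ξ ρ).hasDerivWithinAt) (fun u hu => ?_) (convex_Icc 0 1) hs ht
  refine (norm_add_le _ _).trans ?_
  rw [norm_mul, norm_mul, Complex.norm_I, one_mul, Complex.norm_real, Complex.norm_real,
    Real.norm_eq_abs, Real.norm_eq_abs]
  have h1 := mul_le_mul_of_nonneg_left (norm_gam_le ξ hu hρ) hξ
  have h2 := abs_sin_mul_div_le hu hρ
  refine (add_le_add h1 h2).trans ?_
  rw [show 2 / (1 + ρ) = 2 * (1 + |(|ξ| - ρ)|) / ((1 + ρ) * (1 + |(|ξ| - ρ)|)) by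
    field_simp, mul_div_assoc', ← add_div]
  gcongr
  linarith

lemma norm_gam_sub_gam_le_rpow {s t ρ ε : ℝ} (ξ : ℝ) (hs : s ∈ Icc (0 : ℝ) 1)
    (ht : t ∈ Icc (0 : ℝ) 1) (hρ : 0 < ρ) (hε : 0 < ε) (hε1 : ε ≤ 1) :
    ‖gam t ξ ρ - gam s ξ ρ‖ ≤
      16 / ((1 + ρ) * (1 + |(|ξ| - ρ)|)) * (|t - s| ^ ε * (1 + |ξ| + ρ) ^ ε) := by
  have hξ := abs_nonneg ξ
  have hw0 := abs_nonneg (|ξ| - ρ)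
  rw [← Real.mul_rpow (abs_nonneg _) (by linarith)]
  set x := |t - s| * (1 + |ξ| + ρ) with hx
  have hx0 : 0 ≤ x := by positivity
  rcases le_total x 1 with h | h
  · have h1 : x ≤ x ^ ε := by
      simpa using Real.rpow_le_rpow_of_exponent_ge' hx0 h hε.le hε1
    refine (norm_gam_sub_gam_le ξ hs ht hρ).trans ?_
    calc _ = 10 / ((1 + ρ) * (1 + |(|ξ| - ρ)|)) * x := by rw [hx]; ring
      _ ≤ _ := by gcongr; norm_num
  · have h1 : 1 ≤ x ^ ε := Real.one_le_rpow h hε.le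
    refine (norm_sub_le _ _).trans ((add_le_add (norm_gam_le ξ ht hρ)
      (norm_gam_le ξ hs hρ)).trans ?_)
    rw [← add_div]
    norm_num only
    exact le_mul_of_one_le_right (by positivity) h1

lemma rpow_mul_rpow_div_sq_le {a b ρ : ℝ} (x : ℝ) (ha : 0 ≤ a) (ha1 : a ≤ 1) (hb : -1 ≤ b)
    (hb1 : b ≤ 1) (hρ : 0 < ρ) :
    (1 + |x| + ρ) ^ a * |x| ^ b / (1 + |(|x| - ρ)|) ^ 2 ≤
      8 * ((1 + ρ) ^ (a + b - 2) * powProfile b (a + b - 2) (x / (1 + ρ)) +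
        (1 + ρ) ^ (a + b) * (1 + (|x| - ρ) ^ 2)⁻¹) := by
  set R := 1 + ρ with hR
  have hR0 : 0 < R := by linarith
  have hx0 := abs_nonneg x
  have hw0 := abs_nonneg (|x| - ρ)
  have h2a : (2 : ℝ) ^ a ≤ 2 := by
    simpa using Real.rpow_le_rpow_of_exponent_le one_le_two ha1
  have h3a : (3 : ℝ) ^ a ≤ 3 := by
    simpa using Real.rpow_le_rpow_of_exponent_le (by norm_num : (1 : ℝ) ≤ 3) ha1
  have hxR : |x / R| = |x| / R := by rw [abs_div, abs_of_pos hR0]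
  have hP := powProfile_nonneg b (a + b - 2) (x / R)
  rcases le_or_gt |x| (R / 2) with h | h
  · have hw : R / 2 ≤ 1 + |(|x| - ρ)| := by linarith [neg_abs_le (|x| - ρ)]
    have hval : R ^ (a + b - 2) * powProfile b (a + b - 2) (x / R) =
        R ^ a * |x| ^ b / R ^ 2 := by
      have : |x / R| ≤ 1 := by rw [hxR, div_le_one hR0]; linarith
      rw [powProfile, if_pos this, hxR, Real.div_rpow hx0 hR0.le, Real.rpow_sub hR0,
        Real.rpow_add hR0, Real.rpow_two]
      field_simp
    calc _ ≤ (2 * R) ^ a * |x| ^ b / (R / 2) ^ 2 := by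
          gcongr
          linarith
      _ = 2 ^ a * 4 * (R ^ a * |x| ^ b / R ^ 2) := by
          rw [Real.mul_rpow two_pos.le hR0.le]; ring_nf
      _ ≤ 8 * (R ^ a * |x| ^ b / R ^ 2) := by gcongr; linarith
      _ ≤ _ := by rw [hval]; gcongr; exact le_add_of_nonneg_right (by positivity)
  · have hx : 0 < |x| := by linarith
    rcases le_or_gt |x| (2 * R) with h' | h'
    · have hxb : |x| ^ b ≤ 2 * R ^ b := by
        rw [← div_le_iff₀ (by positivity), ← Real.div_rpow hx0 hR0.le]
        have l1 : 1 / 2 ≤ |x| / R := by rw [div_le_div_iff₀ two_pos hR0]; linarith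
        have l2 : |x| / R ≤ 2 := by rw [div_le_iff₀ hR0]; linarith
        rcases le_total 0 b with hb0 | hb0
        · calc (|x| / R) ^ b ≤ 2 ^ b := by gcongr
            _ ≤ 2 ^ (1 : ℝ) := Real.rpow_le_rpow_of_exponent_le one_le_two hb1
            _ = 2 := Real.rpow_one 2
        · calc (|x| / R) ^ b ≤ (1 / 2) ^ b :=
                Real.rpow_le_rpow_of_nonpos (by norm_num) l1 hb0
            _ ≤ (1 / 2) ^ (-1 : ℝ) :=
                Real.rpow_le_rpow_of_exponent_ge (by norm_num) (by norm_num) hb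
            _ = 2 := by rw [Real.rpow_neg_one]; norm_num
      calc _ ≤ (3 * R) ^ a * (2 * R ^ b) / (1 + (|x| - ρ) ^ 2) := by
            gcongr
            · linarith
            · nlinarith [sq_abs (|x| - ρ)]
        _ = (2 * 3 ^ a) * (R ^ (a + b) * (1 + (|x| - ρ) ^ 2)⁻¹) := by
            rw [Real.mul_rpow (by norm_num) hR0.le, Real.rpow_add hR0]; ring
        _ ≤ 8 * (R ^ (a + b) * (1 + (|x| - ρ) ^ 2)⁻¹) := by gcongr; linarith
        _ ≤ _ := by gcongr; exact le_add_of_nonneg_left (by positivity)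
    · have hw : |x| / 2 ≤ 1 + |(|x| - ρ)| := by linarith [le_abs_self (|x| - ρ)]
      have hval : R ^ (a + b - 2) * powProfile b (a + b - 2) (x / R) =
          |x| ^ a * |x| ^ b / |x| ^ 2 := by
        have : ¬ |x / R| ≤ 1 := by rw [hxR, div_le_one hR0]; linarith
        rw [powProfile, if_neg this, hxR, ← Real.mul_rpow hR0.le (by positivity),
          mul_div_cancel₀ _ hR0.ne', Real.rpow_sub hx, Real.rpow_add hx, Real.rpow_two]
      calc _ ≤ (2 * |x|) ^ a * |x| ^ b / (|x| / 2) ^ 2 := by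
            gcongr
            linarith
        _ = 2 ^ a * 4 * (|x| ^ a * |x| ^ b / |x| ^ 2) := by
            rw [Real.mul_rpow two_pos.le hx0]; ring
        _ ≤ 8 * (|x| ^ a * |x| ^ b / |x| ^ 2) := by gcongr; linarith
        _ ≤ _ := by rw [hval]; gcongr; exact le_add_of_nonneg_right (by positivity)

/-- An integrable majorant on the line, with integral controlled by a power of `1 + ρ`. -/
lemma exists_integrable_majorant {a b : ℝ} (ha : 0 ≤ a) (ha1 : a ≤ 1) (hb : -1 < b)
    (hb1 : b ≤ 1) (hab : a + b < 1) :
    ∃ C : ℝ, 0 < C ∧ ∀ ρ : ℝ, 0 < ρ → ∃ g : ℝ → ℝ, Integrable g ∧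
      (∀ x, (1 + |x| + ρ) ^ a * |x| ^ b / (1 + |(|x| - ρ)|) ^ 2 ≤ g x) ∧
      ∫ x, g x ≤ C * (1 + ρ) ^ (a + b) := by
  have hf : Integrable (powProfile b (a + b - 2)) := integrable_powProfile hb (by linarith)
  set I := ∫ x, powProfile b (a + b - 2) x with hI
  have hI0 : 0 ≤ I := integral_nonneg fun x => powProfile_nonneg _ _ x
  refine ⟨8 * (I + 2 * Real.pi), by positivity, fun ρ hρ => ?_⟩
  have hR0 : 0 < 1 + ρ := by linarith
  have hf' := (hf.comp_div hR0.ne').const_mul ((1 + ρ) ^ (a + b - 2))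
  have hc1 := integrable_inv_one_add_sq.comp_sub_right ρ
  have hc2 := integrable_inv_one_add_sq.comp_add_right ρ
  have hc := (hc1.add hc2).const_mul ((1 + ρ) ^ (a + b))
  refine ⟨_, (hf'.add hc).const_mul 8, fun x => ?_, ?_⟩
  · refine (rpow_mul_rpow_div_sq_le x ha ha1 hb.le hb1 hρ).trans ?_
    simp only [Pi.add_apply]
    gcongr
    rcases abs_cases x with ⟨h, _⟩ | ⟨h, _⟩
    · rw [h]
      exact le_add_of_nonneg_right (by positivity)
    · rw [h, show (-x - ρ) ^ 2 = (x + ρ) ^ 2 by ring]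
      exact le_add_of_nonneg_left (by positivity)
  · rw [integral_const_mul, integral_add' hf' hc, integral_const_mul, integral_const_mul,
      integral_add' hc1 hc2, Measure.integral_comp_div, integral_sub_right_eq_self
        (fun x : ℝ => (1 + x ^ 2)⁻¹), integral_add_right_eq_self (fun x : ℝ => (1 + x ^ 2)⁻¹),
      integral_univ_inv_one_add_sq, ← hI, abs_of_pos hR0, smul_eq_mul]
    have h1 : (1 + ρ) ^ (a + b - 2) * (1 + ρ) ≤ (1 + ρ) ^ (a + b) := by
      nth_rewrite 2 [← Real.rpow_one (1 + ρ)]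
      rw [← Real.rpow_add hR0]
      exact Real.rpow_le_rpow_of_exponent_le (by linarith) (by linarith)
    nlinarith [mul_le_mul_of_nonneg_right h1 hI0]

lemma one_add_rpow_neg_le {ρ p : ℝ} (hρ : 0 < ρ) (hp : 0 ≤ p) :
    (1 + ρ) ^ (-p) ≤ 2 / (1 + ρ ^ p) := by
  have hR0 : 0 < 1 + ρ := by linarith
  rw [Real.rpow_neg hR0.le, ← one_div, div_le_div_iff₀ (by positivity) (by positivity)]
  have h1 : ρ ^ p ≤ (1 + ρ) ^ p := by gcongr; linarith
  have h2 : 1 ≤ (1 + ρ) ^ p := Real.one_le_rpow (by linarith) hp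
  linarith

lemma measurableSet_Anm (n m : ℕ) (ρ : ℝ) : MeasurableSet (Anm n m ρ) := by
  have habs : Measurable fun ξ : ℝ => |ξ| := measurable_id.abs
  unfold Anm
  split_ifs
  · exact measurableSet_le habs measurable_const
  · exact (measurableSet_lt measurable_const habs).inter
      (measurableSet_le habs measurable_const)

lemma two_pow_le_of_mem_Anm {n m : ℕ} {ρ ξ : ℝ} (hρ : 0 < ρ) (h : ξ ∈ Anm n m ρ) :
    (2 : ℝ) ^ n ≤ 1 + |ξ| + ρ := by
  have hξ := abs_nonneg ξ
  unfold Anm at h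
  split_ifs at h with h'
  · linarith
  · linarith [h.1]

lemma Kker_nonneg (H₀ H₁ H₂ x y : ℝ) : 0 ≤ Kker H₀ H₁ H₂ x y := by
  unfold Kker
  positivity

lemma exists_norm_integral_gam_le {H₀ ε : ℝ} (h₀ : H₀ ∈ Ioo (0:ℝ) 1) (hε : 0 < ε)
    (hεH : ε < H₀) (hε4 : ε < 1 / 4) :
    ∃ C : ℝ, 0 < C ∧ ∀ n m : ℕ, ∀ s ∈ Icc (0:ℝ) 1, ∀ t ∈ Icc (0:ℝ) 1, ∀ ρ : ℝ, 0 < ρ →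
      ‖∫ ξ in Anm n m ρ, (gam t ξ ρ - gam s ξ ρ) * (starRingEnd ℂ) (gam t ξ ρ) *
          ((|ξ| ^ (1 - 2*H₀) : ℝ) : ℂ)‖ ≤
        C * (2:ℝ) ^ (-(n:ℝ) * ε) * |t - s| ^ ε * (1 / (1 + ρ ^ (1 + 2 * (H₀ - ε)))) := by
  obtain ⟨C, hC, hmaj⟩ := exists_integrable_majorant (a := 2 * ε) (b := 1 - 2 * H₀)
    (by linarith) (by linarith) (by linarith [h₀.2]) (by linarith [h₀.1]) (by linarith)
  refine ⟨256 * C, by positivity, fun n m s hs t ht ρ hρ => ?_⟩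
  obtain ⟨g, hg, hle, hint⟩ := hmaj ρ hρ
  have hR0 : 0 < 1 + ρ := by linarith
  set D := 128 * ((2:ℝ) ^ (-(n:ℝ) * ε) * |t - s| ^ ε) / (1 + ρ) ^ 2 with hD
  have hD0 : 0 ≤ D := by positivity
  have hg0 : ∀ x, 0 ≤ g x := fun x => le_trans (by positivity) (hle x)
  have hbound : ∀ ξ ∈ Anm n m ρ, ‖(gam t ξ ρ - gam s ξ ρ) * (starRingEnd ℂ) (gam t ξ ρ) *
      ((|ξ| ^ (1 - 2*H₀) : ℝ) : ℂ)‖ ≤ D * g ξ := by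
    intro ξ hξ
    have hξ0 := abs_nonneg ξ
    have hS0 : 0 < 1 + |ξ| + ρ := by linarith
    have hS : (1 + |ξ| + ρ) ^ ε ≤ (2:ℝ) ^ (-(n:ℝ) * ε) * (1 + |ξ| + ρ) ^ (2 * ε) := by
      have h1 : (2:ℝ) ^ ((n:ℝ) * ε) ≤ (1 + |ξ| + ρ) ^ ε := by
        rw [Real.rpow_mul two_pos.le, Real.rpow_natCast]
        gcongr
        exact two_pow_le_of_mem_Anm hρ hξ
      rw [neg_mul, Real.rpow_neg two_pos.le, inv_mul_eq_div, le_div_iff₀ (by positivity),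
        two_mul, Real.rpow_add hS0]
      gcongr
    rw [norm_mul, norm_mul, RCLike.norm_conj, Complex.norm_real, Real.norm_eq_abs,
      abs_of_nonneg (by positivity : 0 ≤ |ξ| ^ (1 - 2 * H₀))]
    calc _ ≤ (16 / ((1 + ρ) * (1 + |(|ξ| - ρ)|)) * (|t - s| ^ ε *
          ((2:ℝ) ^ (-(n:ℝ) * ε) * (1 + |ξ| + ρ) ^ (2 * ε)))) *
          (8 / ((1 + ρ) * (1 + |(|ξ| - ρ)|))) * |ξ| ^ (1 - 2 * H₀) := by
          gcongr
          · refine (norm_gam_sub_gam_le_rpow ξ hs ht hρ hε (by linarith)).trans ?_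
            gcongr
          · exact norm_gam_le ξ ht hρ
      _ = D * ((1 + |ξ| + ρ) ^ (2 * ε) * |ξ| ^ (1 - 2 * H₀) / (1 + |(|ξ| - ρ)|) ^ 2) := by
          rw [hD]
          field_simp
          ring
      _ ≤ _ := by gcongr; exact hle ξ
  have hDg : Integrable (fun ξ => D * g ξ) := hg.const_mul D
  have hpow : (1 + ρ) ^ (2 * ε + (1 - 2 * H₀)) / (1 + ρ) ^ 2 ≤
      2 / (1 + ρ ^ (1 + 2 * (H₀ - ε))) := by
    rw [← Real.rpow_two, ← Real.rpow_sub hR0,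
      show 2 * ε + (1 - 2 * H₀) - 2 = -(1 + 2 * (H₀ - ε)) by ring]
    exact one_add_rpow_neg_le hρ (by linarith)
  calc _ ≤ ∫ ξ in Anm n m ρ, D * g ξ :=
        norm_integral_le_of_norm_le hDg.integrableOn
          ((ae_restrict_iff' (measurableSet_Anm n m ρ)).2 (ae_of_all _ hbound))
    _ ≤ ∫ ξ, D * g ξ :=
        setIntegral_le_integral hDg (ae_of_all _ fun ξ => mul_nonneg hD0 (hg0 ξ))
    _ = D * ∫ ξ, g ξ := integral_const_mul _ _
    _ ≤ D * (C * (1 + ρ) ^ (2 * ε + (1 - 2 * H₀))) := by gcongr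
    _ = 128 * C * ((2:ℝ) ^ (-(n:ℝ) * ε) * |t - s| ^ ε) *
        ((1 + ρ) ^ (2 * ε + (1 - 2 * H₀)) / (1 + ρ) ^ 2) := by rw [hD]; ring
    _ ≤ 128 * C * ((2:ℝ) ^ (-(n:ℝ) * ε) * |t - s| ^ ε) *
        (2 / (1 + ρ ^ (1 + 2 * (H₀ - ε)))) := by gcongr
    _ = _ := by ring

/-- bound
`|L^{H,((n,m),m)}_{(s,t),t}(η)| ≲ 2^{−nε}|t−s|^ε (K^{H_{ε,0}} + K^{H_{ε,1}} + K^{H_{ε,2}})(η)`. -/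
theorem stmt_7 (H₀ H₁ H₂ : ℝ) (h₀ : H₀ ∈ Ioo (0:ℝ) 1) (h₁ : H₁ ∈ Ioo (0:ℝ) 1)
    (h₂ : H₂ ∈ Ioo (0:ℝ) 1) (ε : ℝ) (hε : 0 < ε) (hε' : ε < min H₀ (1/4)) :
    ∃ C : ℝ, 0 < C ∧ ∀ n m : ℕ, n ≤ m → ∀ s ∈ Icc (0:ℝ) 1, ∀ t ∈ Icc (0:ℝ) 1,
      ∀ η₁ η₂ : ℝ, η₁ ≠ 0 → η₂ ≠ 0 → Real.sqrt (η₁^2 + η₂^2) ≤ 2^m →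
      |η₁| ^ (1 - 2*H₁) * |η₂| ^ (1 - 2*H₂) *
        ‖∫ ξ in Anm n m (Real.sqrt (η₁^2 + η₂^2)),
            (gam t ξ (Real.sqrt (η₁^2 + η₂^2)) - gam s ξ (Real.sqrt (η₁^2 + η₂^2))) *
              (starRingEnd ℂ) (gam t ξ (Real.sqrt (η₁^2 + η₂^2))) *
              ((|ξ| ^ (1 - 2*H₀) : ℝ) : ℂ)‖ ≤
      C * (2:ℝ) ^ (-(n:ℝ) * ε) * |t - s| ^ ε *
        (Kker (H₀ - ε) H₁ H₂ η₁ η₂ + Kker H₀ (H₁ - ε) H₂ η₁ η₂ +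
          Kker H₀ H₁ (H₂ - ε) η₁ η₂) := by
  have hεH : ε < H₀ := hε'.trans_le (min_le_left _ _)
  have hε4 : ε < 1 / 4 := hε'.trans_le (min_le_right _ _)
  obtain ⟨C, hC, hmain⟩ := exists_norm_integral_gam_le h₀ hε hεH hε4
  refine ⟨C, hC, fun n m _ s hs t ht η₁ η₂ hη₁ _ _ => ?_⟩
  have hρ : 0 < Real.sqrt (η₁^2 + η₂^2) := Real.sqrt_pos.2 (by positivity)
  have hK1 := Kker_nonneg H₀ (H₁ - ε) H₂ η₁ η₂
  have hK2 := Kker_nonneg H₀ H₁ (H₂ - ε) η₁ η₂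
  calc _ ≤ |η₁| ^ (1 - 2*H₁) * |η₂| ^ (1 - 2*H₂) *
        (C * (2:ℝ) ^ (-(n:ℝ) * ε) * |t - s| ^ ε *
          (1 / (1 + Real.sqrt (η₁^2 + η₂^2) ^ (1 + 2 * (H₀ - ε))))) := by
        gcongr
        exact hmain n m s hs t ht _ hρ
    _ = C * (2:ℝ) ^ (-(n:ℝ) * ε) * |t - s| ^ ε * Kker (H₀ - ε) H₁ H₂ η₁ η₂ := by
        rw [Kker]; ring
    _ ≤ _ := by gcongr; linarith
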